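/- Assume that for every γ ∈ ℝ there exist ξ(γ) > 0 with μ⁽¹⁾(γ,ξ(γ)) = Θ(γ) and a ground state φ_γ of H[γ,ξ(γ)] (a twice continuously differentiable positive function with ∫₀^∞ φ_γ(t)² dt = 1, φ_γ, φ_γ', t²·φ_γ(t) ∈ L²((0,∞)), satisfying −φ_γ''(t) + (t−ξ(γ))²φ_γ(t) = Θ(γ)·φ_γ(t) and φ_γ'(0) = γ·φ_γ(0)). Then the function γ ↦ Θ(γ) is differentiable at every γ ∈ ℝ with Θ'(γ) = |φ_γ(0)|². -/

import Mathlib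

open MeasureTheory Set Filter

/-- An admissible function on the half-line `[0,∞)`: `u` is continuous on `[0,∞)`,
locally absolutely continuous with derivative `u'` (expressed by the integral
representation), and `u`, `u'`, `t·u(t)` all belong to `L²((0,∞))`. -/
structure AdmissibleHL (u u' : ℝ → ℂ) : Prop where
  cont : ContinuousOn u (Ici 0)
  locInt : ∀ t ∈ Ici (0:ℝ), IntervalIntegrable u' volume 0 t
  ac : ∀ t ∈ Ici (0:ℝ), u t = u 0 + ∫ s in (0:ℝ)..t, u' s
  memL2 : IntegrableOn (fun t => ‖u t‖ ^ 2) (Ioi 0)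
  memL2' : IntegrableOn (fun t => ‖u' t‖ ^ 2) (Ioi 0)
  memL2t : IntegrableOn (fun t => t ^ 2 * ‖u t‖ ^ 2) (Ioi 0)

/-- The quadratic form `q[γ,ξ](u) = ∫₀^∞ (|u'|² + (t-ξ)²|u|²) dt + γ|u(0)|²`. -/
noncomputable def qform (γ ξ : ℝ) (u u' : ℝ → ℂ) : ℝ :=
  (∫ t in Ioi (0:ℝ), (‖u' t‖ ^ 2 + (t - ξ) ^ 2 * ‖u t‖ ^ 2)) + γ * ‖u 0‖ ^ 2

/-- The ground state energy `μ⁽¹⁾(γ,ξ)`: the infimum of the Rayleigh quotients of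
the quadratic form `q[γ,ξ]` over admissible functions not identically zero. -/
noncomputable def mu1 (γ ξ : ℝ) : ℝ :=
  sInf { r : ℝ | ∃ u u' : ℝ → ℂ, AdmissibleHL u u' ∧ (∃ t ∈ Ici (0:ℝ), u t ≠ 0) ∧
    r = qform γ ξ u u' / ∫ t in Ioi (0:ℝ), ‖u t‖ ^ 2 }

/-- `Θ(γ) = inf_{ξ ∈ ℝ} μ⁽¹⁾(γ,ξ)`. -/
noncomputable def Theta (γ : ℝ) : ℝ := ⨅ ξ : ℝ, mu1 γ ξ

/-- A ground state of `H[γ,ξ]` with eigenvalue `μ`: a twice continuously differentiable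
positive function on `[0,∞)`, `L²`-normalized, with `φ, φ', t²·φ(t) ∈ L²((0,∞))`,
satisfying `-φ'' + (t-ξ)²φ = μ·φ` on `[0,∞)` and the boundary condition `φ'(0) = γ·φ(0)`. -/
structure IsGroundState (γ ξ μ : ℝ) (φ φ' φ'' : ℝ → ℝ) : Prop where
  deriv1 : ∀ t ∈ Ici (0:ℝ), HasDerivWithinAt φ (φ' t) (Ici 0) t
  deriv2 : ∀ t ∈ Ici (0:ℝ), HasDerivWithinAt φ' (φ'' t) (Ici 0) t
  cont2 : ContinuousOn φ'' (Ici 0)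
  pos : ∀ t ∈ Ici (0:ℝ), 0 < φ t
  normalized : (∫ t in Ioi (0:ℝ), (φ t) ^ 2) = 1
  memL2 : IntegrableOn (fun t => (φ t) ^ 2) (Ioi 0)
  memL2' : IntegrableOn (fun t => (φ' t) ^ 2) (Ioi 0)
  memL2t : IntegrableOn (fun t => (t ^ 2 * φ t) ^ 2) (Ioi 0)
  eqn : ∀ t ∈ Ici (0:ℝ), -φ'' t + (t - ξ) ^ 2 * φ t = μ * φ t
  bc : φ' 0 = γ * φ 0

/-- Trace inequality on the half-line. -/
lemma AdmissibleHL.norm_sq_zero_le {u u' : ℝ → ℂ} (hu : AdmissibleHL u u') {a : ℝ} (ha : 0 < a) :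
    ‖u 0‖ ^ 2 ≤ 2 / a * (∫ t in Ioi (0:ℝ), ‖u t‖ ^ 2) +
      2 * a * ∫ t in Ioi (0:ℝ), ‖u' t‖ ^ 2 := by
  have hpt : ∀ t ∈ Ioc (0:ℝ) a,
      ‖u 0‖ ^ 2 / 2 - a * (∫ t in Ioi (0:ℝ), ‖u' t‖ ^ 2) ≤ ‖u t‖ ^ 2 := by
    intro t ht
    have hint := hu.locInt t ht.1.le
    have hsub : Ioc 0 t ⊆ Ioi (0:ℝ) := fun x hx => hx.1
    have hsq : IntervalIntegrable (fun s => ‖u' s‖ ^ 2) volume 0 t := by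
      rw [intervalIntegrable_iff_integrableOn_Ioc_of_le ht.1.le]
      exact hu.memL2'.mono_set hsub
    have hB : ‖u 0‖ ≤ ‖u t‖ + ∫ s in (0:ℝ)..t, ‖u' s‖ := by
      have e : u 0 = u t - ∫ s in (0:ℝ)..t, u' s := by rw [hu.ac t ht.1.le]; ring
      calc ‖u 0‖ ≤ ‖u t‖ + ‖∫ s in (0:ℝ)..t, u' s‖ := by
            conv_lhs => rw [e]
            exact norm_sub_le _ _
        _ ≤ _ := by
            gcongr
            exact intervalIntegral.norm_integral_le_integral_norm ht.1.le
    have hM : ‖u 0‖ * ∫ s in (0:ℝ)..t, ‖u' s‖ ≤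
        a * (∫ s in (0:ℝ)..t, ‖u' s‖ ^ 2) + t * (‖u 0‖ ^ 2 / (4 * a)) := by
      calc ‖u 0‖ * ∫ s in (0:ℝ)..t, ‖u' s‖ = ∫ s in (0:ℝ)..t, ‖u 0‖ * ‖u' s‖ := by
            rw [intervalIntegral.integral_const_mul]
        _ ≤ ∫ s in (0:ℝ)..t, (a * ‖u' s‖ ^ 2 + ‖u 0‖ ^ 2 / (4 * a)) := by
            apply intervalIntegral.integral_mono_on ht.1.le (hint.norm.const_mul _)
              ((hsq.const_mul _).add intervalIntegrable_const)
            intro s _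
            have : a * ‖u' s‖ ^ 2 + ‖u 0‖ ^ 2 / (4 * a) - ‖u 0‖ * ‖u' s‖ =
                (2 * a * ‖u' s‖ - ‖u 0‖) ^ 2 / (4 * a) := by field_simp; ring
            have : 0 ≤ (2 * a * ‖u' s‖ - ‖u 0‖) ^ 2 / (4 * a) := by positivity
            linarith
        _ = _ := by
            rw [intervalIntegral.integral_add (hsq.const_mul _) intervalIntegrable_const,
              intervalIntegral.integral_const_mul, intervalIntegral.integral_const]
            simp
    have hD : ∫ s in (0:ℝ)..t, ‖u' s‖ ^ 2 ≤ ∫ t in Ioi (0:ℝ), ‖u' t‖ ^ 2 := by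
      rw [intervalIntegral.integral_of_le ht.1.le]
      exact setIntegral_mono_set hu.memL2' (ae_of_all _ fun _ => by positivity)
        hsub.eventuallyLE
    have ht' : t * (‖u 0‖ ^ 2 / (4 * a)) ≤ ‖u 0‖ ^ 2 / 4 := by
      calc t * (‖u 0‖ ^ 2 / (4 * a)) ≤ a * (‖u 0‖ ^ 2 / (4 * a)) := by gcongr; exact ht.2
        _ = _ := by field_simp
    nlinarith [norm_nonneg (u 0), mul_le_mul_of_nonneg_left hB (norm_nonneg (u 0)),
      mul_le_mul_of_nonneg_left hD ha.le, sq_nonneg (‖u 0‖ - 2 * ‖u t‖)]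
  have hsub : Ioc 0 a ⊆ Ioi (0:ℝ) := fun x hx => hx.1
  have hint : a * (‖u 0‖ ^ 2 / 2 - a * (∫ t in Ioi (0:ℝ), ‖u' t‖ ^ 2)) ≤
      ∫ t in Ioi (0:ℝ), ‖u t‖ ^ 2 := by
    calc _ = ∫ t in Ioc (0:ℝ) a, (‖u 0‖ ^ 2 / 2 - a * (∫ t in Ioi (0:ℝ), ‖u' t‖ ^ 2)) := by
          simp [ha.le]
      _ ≤ ∫ t in Ioc (0:ℝ) a, ‖u t‖ ^ 2 :=
          setIntegral_mono_on (by simp) (hu.memL2.mono_set hsub) measurableSet_Ioc hpt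
      _ ≤ _ := setIntegral_mono_set hu.memL2 (ae_of_all _ fun _ => by positivity)
          hsub.eventuallyLE
  have := mul_le_mul_of_nonneg_left hint (show 0 ≤ 2 / a by positivity)
  have e : 2 / a * (a * (‖u 0‖ ^ 2 / 2 - a * (∫ t in Ioi (0:ℝ), ‖u' t‖ ^ 2))) =
      ‖u 0‖ ^ 2 - 2 * a * (∫ t in Ioi (0:ℝ), ‖u' t‖ ^ 2) := by field_simp
  linarith

lemma AdmissibleHL.integrableOn_potential {u u' : ℝ → ℂ} (hu : AdmissibleHL u u') (ξ : ℝ) :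
    IntegrableOn (fun t => (t - ξ) ^ 2 * ‖u t‖ ^ 2) (Ioi 0) := by
  refine Integrable.mono' ((hu.memL2t.const_mul 2).add (hu.memL2.const_mul (2 * ξ ^ 2))) ?_ ?_
  · exact (Continuous.aestronglyMeasurable (by fun_prop)).mul hu.memL2.aestronglyMeasurable
  · refine ae_of_all _ fun t => ?_
    rw [Real.norm_of_nonneg (by positivity)]
    simp only [Pi.add_apply]
    nlinarith [mul_nonneg (sq_nonneg (t + ξ)) (sq_nonneg ‖u t‖)]

/-- The form `q[γ,ξ]` is bounded below, uniformly in `ξ`. -/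
lemma AdmissibleHL.neg_mul_le_qform {u u' : ℝ → ℂ} (hu : AdmissibleHL u u') (γ ξ : ℝ) :
    -(4 * |γ| * (|γ| + 1)) * (∫ t in Ioi (0:ℝ), ‖u t‖ ^ 2) ≤ qform γ ξ u u' := by
  have htr := hu.norm_sq_zero_le (a := 1 / (2 * (|γ| + 1))) (by positivity)
  have hD0 : 0 ≤ ∫ t in Ioi (0:ℝ), ‖u' t‖ ^ 2 := integral_nonneg fun _ => by positivity
  have hD : ∫ t in Ioi (0:ℝ), ‖u' t‖ ^ 2 ≤
      ∫ t in Ioi (0:ℝ), (‖u' t‖ ^ 2 + (t - ξ) ^ 2 * ‖u t‖ ^ 2) :=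
    integral_mono hu.memL2' (hu.memL2'.add (hu.integrableOn_potential ξ)) fun t => by
      have : 0 ≤ (t - ξ) ^ 2 * ‖u t‖ ^ 2 := by positivity
      dsimp only
      linarith
  set N := ∫ t in Ioi (0:ℝ), ‖u t‖ ^ 2
  set D := ∫ t in Ioi (0:ℝ), ‖u' t‖ ^ 2
  have h1 := mul_le_mul_of_nonneg_left htr (abs_nonneg γ)
  have h2 : |γ| * (2 / (1 / (2 * (|γ| + 1))) * N + 2 * (1 / (2 * (|γ| + 1))) * D) =
      4 * |γ| * (|γ| + 1) * N + |γ| / (|γ| + 1) * D := by field_simp; ring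
  have h3 : |γ| / (|γ| + 1) * D ≤ 1 * D := by
    gcongr
    rw [div_le_one (by positivity)]
    linarith
  have h4 : -|γ| * ‖u 0‖ ^ 2 ≤ γ * ‖u 0‖ ^ 2 := by
    gcongr
    exact neg_abs_le γ
  unfold qform
  linarith

lemma neg_le_rayleigh {u u' : ℝ → ℂ} (hu : AdmissibleHL u u') (γ ξ : ℝ) :
    -(4 * |γ| * (|γ| + 1)) ≤ qform γ ξ u u' / ∫ t in Ioi (0:ℝ), ‖u t‖ ^ 2 := by
  have hN0 : 0 ≤ ∫ t in Ioi (0:ℝ), ‖u t‖ ^ 2 := integral_nonneg fun _ => by positivity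
  rcases hN0.eq_or_lt with h0 | h0
  · rw [← h0, div_zero, neg_nonpos]
    positivity
  · rw [le_div_iff₀ h0]
    exact hu.neg_mul_le_qform γ ξ

lemma neg_le_mu1 (γ ξ : ℝ) : -(4 * |γ| * (|γ| + 1)) ≤ mu1 γ ξ := by
  refine Real.le_sInf ?_ ?_
  · rintro _ ⟨u, u', hu, -, rfl⟩
    exact neg_le_rayleigh hu γ ξ
  · rw [neg_nonpos]
    positivity

lemma Theta_le_rayleigh {u u' : ℝ → ℂ} (hu : AdmissibleHL u u') (hne : ∃ t ∈ Ici (0:ℝ), u t ≠ 0)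
    (γ ξ : ℝ) : Theta γ ≤ qform γ ξ u u' / ∫ t in Ioi (0:ℝ), ‖u t‖ ^ 2 := by
  have h1 : Theta γ ≤ mu1 γ ξ :=
    ciInf_le ⟨-(4 * |γ| * (|γ| + 1)), by rintro _ ⟨x, rfl⟩; exact neg_le_mu1 γ x⟩ ξ
  refine h1.trans (csInf_le ⟨-(4 * |γ| * (|γ| + 1)), ?_⟩ ⟨u, u', hu, hne, rfl⟩)
  rintro _ ⟨v, v', hv, -, rfl⟩
  exact neg_le_rayleigh hv γ ξ

lemma integrableOn_Ioi_of_abs_le {f g : ℝ → ℝ} (hf : ContinuousOn f (Ici 0))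
    (hg : IntegrableOn g (Ioi 0)) (hfg : ∀ t, |f t| ≤ g t) : IntegrableOn f (Ioi 0) :=
  Integrable.mono' hg
    ((hf.mono Ioi_subset_Ici_self).aestronglyMeasurable measurableSet_Ioi) (ae_of_all _ hfg)

/-- If `f` and `f'` are integrable on the half-line, then `∫ f' = -f 0`. -/
lemma integral_Ioi_deriv_eq_neg {f f' : ℝ → ℝ}
    (hf : ∀ t ∈ Ici (0:ℝ), HasDerivWithinAt f (f' t) (Ici 0) t)
    (hint : IntegrableOn f (Ioi 0)) (hint' : IntegrableOn f' (Ioi 0)) :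
    ∫ t in Ioi (0:ℝ), f' t = -f 0 := by
  have hd : ∀ t ∈ Ioi (0:ℝ), HasDerivAt f (f' t) t :=
    fun t ht => (hf t (Ioi_subset_Ici_self ht)).hasDerivAt (Ici_mem_nhds ht)
  rw [integral_Ioi_of_hasDerivAt_of_tendsto (hf 0 self_mem_Ici).continuousWithinAt hd hint'
    (tendsto_zero_of_hasDerivAt_of_integrableOn_Ioi hd hint' hint), zero_sub]

namespace IsGroundState

variable {γ ξ μ : ℝ} {φ φ' φ'' : ℝ → ℝ}

lemma continuousOn (h : IsGroundState γ ξ μ φ φ' φ'') : ContinuousOn φ (Ici 0) :=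
  fun t ht => (h.deriv1 t ht).continuousWithinAt

lemma continuousOn_deriv (h : IsGroundState γ ξ μ φ φ' φ'') : ContinuousOn φ' (Ici 0) :=
  fun t ht => (h.deriv2 t ht).continuousWithinAt

lemma integrableOn_sq_mul_sq (h : IsGroundState γ ξ μ φ φ' φ'') :
    IntegrableOn (fun t => t ^ 2 * φ t ^ 2) (Ioi 0) := by
  have hc := h.continuousOn
  refine integrableOn_Ioi_of_abs_le (by fun_prop) (h.memL2t.add h.memL2) fun t => ?_
  rw [abs_of_nonneg (by positivity)]
  simp only [Pi.add_apply]
  nlinarith [mul_nonneg (sq_nonneg (t ^ 2 - 1)) (sq_nonneg (φ t)),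
    mul_nonneg (sq_nonneg t) (sq_nonneg (φ t)), sq_nonneg (t ^ 2 * φ t), sq_nonneg (φ t)]

lemma integrableOn_sub_mul_sq (h : IsGroundState γ ξ μ φ φ' φ'') (x : ℝ) :
    IntegrableOn (fun t => (t - x) * φ t ^ 2) (Ioi 0) := by
  have hc := h.continuousOn
  refine integrableOn_Ioi_of_abs_le (by fun_prop)
    (h.integrableOn_sq_mul_sq.add (h.memL2.const_mul (1 + |x|))) fun t => ?_
  rw [abs_mul, abs_of_nonneg (sq_nonneg (φ t))]
  simp only [Pi.add_apply]
  rw [← add_mul]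
  gcongr
  have h1 := abs_sub t x
  nlinarith [sq_nonneg (|t| - 1), sq_abs t]

lemma integrableOn_potential (h : IsGroundState γ ξ μ φ φ' φ'') (x : ℝ) :
    IntegrableOn (fun t => (t - x) ^ 2 * φ t ^ 2) (Ioi 0) := by
  have := (h.integrableOn_sq_mul_sq.sub ((h.integrableOn_sub_mul_sq 0).const_mul (2 * x))).add
    (h.memL2.const_mul (x ^ 2))
  refine this.congr (ae_of_all _ fun t => ?_)
  simp only [Pi.add_apply, Pi.sub_apply]
  ring

lemma admissible (h : IsGroundState γ ξ μ φ φ' φ'') :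
    AdmissibleHL (fun t => (φ t : ℂ)) (fun t => (φ' t : ℂ)) := by
  have hint : ∀ t ∈ Ici (0:ℝ), IntervalIntegrable φ' volume 0 t := fun t ht =>
    (h.continuousOn_deriv.mono (by
      rw [uIcc_of_le ht]; exact Icc_subset_Ici_self)).intervalIntegrable
  refine ⟨?_, fun t ht => ⟨(hint t ht).1.ofReal, (hint t ht).2.ofReal⟩, fun t ht => ?_, ?_, ?_, ?_⟩
  · exact Complex.continuous_ofReal.comp_continuousOn h.continuousOn
  · rw [intervalIntegral.integral_ofReal, intervalIntegral.integral_eq_sub_of_hasDerivAt_of_le ht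
      (h.continuousOn.mono Icc_subset_Ici_self)
      (fun x hx => (h.deriv1 x hx.1.le).hasDerivAt (Ici_mem_nhds hx.1)) (hint t ht)]
    push_cast
    ring
  · simpa using h.memL2
  · simpa using h.memL2'
  · simpa using h.integrableOn_sq_mul_sq

/-- The ground state has energy `μ`. -/
lemma energy (h : IsGroundState γ ξ μ φ φ' φ'') :
    (∫ t in Ioi (0:ℝ), φ' t ^ 2) + (∫ t in Ioi (0:ℝ), (t - ξ) ^ 2 * φ t ^ 2) + γ * φ 0 ^ 2
      = μ := by
  have hc := h.continuousOn
  have hc' := h.continuousOn_deriv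
  have hd : ∀ t ∈ Ici (0:ℝ), HasDerivWithinAt (fun t => φ t * φ' t)
      (φ' t ^ 2 + (t - ξ) ^ 2 * φ t ^ 2 - μ * φ t ^ 2) (Ici 0) t := by
    intro t ht
    refine ((h.deriv1 t ht).mul (h.deriv2 t ht)).congr_deriv ?_
    linear_combination -(φ t) * h.eqn t ht
  have hf : IntegrableOn (fun t => φ t * φ' t) (Ioi 0) := by
    refine integrableOn_Ioi_of_abs_le (by fun_prop) (h.memL2.add h.memL2') fun t => ?_
    simp only [Pi.add_apply]
    rw [abs_le]
    constructor <;> nlinarith [sq_nonneg (φ t + φ' t), sq_nonneg (φ t - φ' t)]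
  have hi1 : IntegrableOn (fun t => φ' t ^ 2 + (t - ξ) ^ 2 * φ t ^ 2) (Ioi 0) :=
    h.memL2'.add (h.integrableOn_potential ξ)
  have key := integral_Ioi_deriv_eq_neg hd hf (hi1.sub (h.memL2.const_mul μ))
  rw [integral_sub hi1 (h.memL2.const_mul μ), integral_add h.memL2' (h.integrableOn_potential ξ),
    integral_const_mul, h.normalized, h.bc] at key
  linarith

/-- The ground state as a trial function for other values of the parameters. -/
lemma Theta_le (h : IsGroundState γ ξ μ φ φ' φ'') (δ s : ℝ) :
    Theta (γ + δ) ≤ μ + δ * φ 0 ^ 2 - 2 * s * (∫ t in Ioi (0:ℝ), (t - ξ) * φ t ^ 2) + s ^ 2 := by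
  have hne : ∃ t ∈ Ici (0:ℝ), (fun t => (φ t : ℂ)) t ≠ 0 :=
    ⟨0, self_mem_Ici, Complex.ofReal_ne_zero.2 (h.pos 0 self_mem_Ici).ne'⟩
  refine (Theta_le_rayleigh h.admissible hne (γ + δ) (ξ + s)).trans_eq ?_
  have hpot : ∫ t in Ioi (0:ℝ), (t - (ξ + s)) ^ 2 * φ t ^ 2 =
      (∫ t in Ioi (0:ℝ), (t - ξ) ^ 2 * φ t ^ 2) -
        2 * s * (∫ t in Ioi (0:ℝ), (t - ξ) * φ t ^ 2) + s ^ 2 := by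
    have i1 := h.integrableOn_potential ξ
    have i2 := (h.integrableOn_sub_mul_sq ξ).const_mul (2 * s)
    have i3 := h.memL2.const_mul (s ^ 2)
    have e : s ^ 2 = ∫ t in Ioi (0:ℝ), s ^ 2 * φ t ^ 2 := by
      rw [integral_const_mul, h.normalized, mul_one]
    rw [e, ← integral_const_mul (2 * s), ← integral_sub i1 i2]
    refine Eq.trans ?_ (integral_add (i1.sub i2) i3)
    congr 1
    ext t
    ring
  simp only [qform, Complex.norm_real, Real.norm_eq_abs, sq_abs]
  rw [h.normalized, integral_add h.memL2' (h.integrableOn_potential _), hpot]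
  linarith [h.energy]

lemma integral_sub_mul_sq_eq_zero (h : IsGroundState γ ξ (Theta γ) φ φ' φ'') :
    ∫ t in Ioi (0:ℝ), (t - ξ) * φ t ^ 2 = 0 := by
  have := h.Theta_le 0 (∫ t in Ioi (0:ℝ), (t - ξ) * φ t ^ 2)
  simp only [add_zero, zero_mul] at this
  nlinarith

/-- At a minimizer, `Θ(γ) = ξ² - γ²`. -/
lemma sq_eq (h : IsGroundState γ ξ (Theta γ) φ φ' φ'') : ξ ^ 2 = Theta γ + γ ^ 2 := by
  have hd : ∀ t ∈ Ici (0:ℝ), HasDerivWithinAt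
      (fun t => φ' t ^ 2 - (t - ξ) ^ 2 * φ t ^ 2 + Theta γ * φ t ^ 2)
      (-2 * ((t - ξ) * φ t ^ 2)) (Ici 0) t := by
    intro t ht
    have h1 := (h.deriv1 t ht).pow 2
    have h2 := (h.deriv2 t ht).pow 2
    have h3 := (((hasDerivAt_id t).sub_const ξ).pow 2).hasDerivWithinAt (s := Ici 0)
    refine ((h2.sub (h3.mul h1)).add (h1.const_mul (Theta γ))).congr_deriv ?_
    simp only [Pi.pow_apply, id, Nat.cast_ofNat]
    linear_combination -(2 * φ' t) * h.eqn t ht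
  have key := integral_Ioi_deriv_eq_neg hd
    ((h.memL2'.sub (h.integrableOn_potential ξ)).add (h.memL2.const_mul _))
    ((h.integrableOn_sub_mul_sq ξ).const_mul _)
  rw [integral_const_mul, h.integral_sub_mul_sq_eq_zero, h.bc] at key
  have hpos : 0 < φ 0 ^ 2 := pow_pos (h.pos 0 self_mem_Ici) 2
  have : φ 0 ^ 2 * (ξ ^ 2 - (Theta γ + γ ^ 2)) = 0 := by linear_combination -key
  rcases mul_eq_zero.1 this with h0 | h0
  · exact absurd h0 hpos.ne'
  · linarith

end IsGroundState

namespace IsGroundState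

variable {γ ξ μ γ' ξ' : ℝ} {φ φ' φ'' ψ ψ' ψ'' : ℝ → ℝ}

lemma setIntegral_sq_le_one (h : IsGroundState γ ξ μ φ φ' φ'') (R : ℝ) :
    ∫ t in Ioc 0 R, φ t ^ 2 ≤ 1 := by
  rw [← h.normalized]
  exact setIntegral_mono_set h.memL2 (ae_of_all _ fun _ => by positivity)
    Ioc_subset_Ioi_self.eventuallyLE

/-- Tightness of the ground state. -/
lemma one_sub_le_setIntegral_sq (h : IsGroundState γ ξ (Theta γ) φ φ' φ'') {R : ℝ} (hR : 0 < R) :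
    1 - (2 * Theta γ + γ ^ 2 - γ * φ 0 ^ 2) / R ^ 2 ≤ ∫ t in Ioc 0 R, φ t ^ 2 := by
  have hsq : ∫ t in Ioi (0:ℝ), t ^ 2 * φ t ^ 2 ≤ 2 * Theta γ + γ ^ 2 - γ * φ 0 ^ 2 := by
    have i1 := h.integrableOn_potential ξ
    have i2 := (h.integrableOn_sub_mul_sq ξ).const_mul (2 * ξ)
    have i3 := h.memL2.const_mul (ξ ^ 2)
    have e : ∫ t in Ioi (0:ℝ), t ^ 2 * φ t ^ 2 =
        (∫ t in Ioi (0:ℝ), (t - ξ) ^ 2 * φ t ^ 2) +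
          (∫ t in Ioi (0:ℝ), 2 * ξ * ((t - ξ) * φ t ^ 2)) +
          ∫ t in Ioi (0:ℝ), ξ ^ 2 * φ t ^ 2 := by
      rw [← integral_add i1 i2]
      refine Eq.trans ?_ (integral_add (i1.add i2) i3)
      congr 1
      ext t
      ring
    rw [e, integral_const_mul, integral_const_mul, h.integral_sub_mul_sq_eq_zero, h.normalized]
    have hD0 : 0 ≤ ∫ t in Ioi (0:ℝ), φ' t ^ 2 := integral_nonneg fun _ => by positivity
    linarith [h.energy, h.sq_eq]
  have hsplit : (∫ t in Ioc 0 R, φ t ^ 2) + ∫ t in Ioi R, φ t ^ 2 = 1 := by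
    rw [← h.normalized, ← setIntegral_union Ioc_disjoint_Ioi_same measurableSet_Ioi
      (h.memL2.mono_set Ioc_subset_Ioi_self) (h.memL2.mono_set (Ioi_subset_Ioi hR.le)),
      Ioc_union_Ioi_eq_Ioi hR.le]
  have hi := h.integrableOn_sq_mul_sq
  have htail : R ^ 2 * ∫ t in Ioi R, φ t ^ 2 ≤ ∫ t in Ioi (0:ℝ), t ^ 2 * φ t ^ 2 := by
    rw [← integral_const_mul]
    refine (setIntegral_mono_on ((h.memL2.mono_set (Ioi_subset_Ioi hR.le)).const_mul _)
      (hi.mono_set (Ioi_subset_Ioi hR.le)) measurableSet_Ioi fun t ht => ?_).trans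
      (setIntegral_mono_set hi (ae_of_all _ fun _ => by positivity)
        (Ioi_subset_Ioi hR.le).eventuallyLE)
    have : R < t := ht
    gcongr
  have : ∫ t in Ioi R, φ t ^ 2 ≤ (2 * Theta γ + γ ^ 2 - γ * φ 0 ^ 2) / R ^ 2 := by
    rw [le_div_iff₀ (by positivity)]
    linarith
  linarith

/-- The Wronskian of two ground states is small on bounded intervals. -/
lemma abs_wronskian_le (h : IsGroundState γ ξ (Theta γ) φ φ' φ'')
    (k : IsGroundState γ' ξ' (Theta γ') ψ ψ' ψ'') {R t : ℝ} (ht : t ∈ Icc 0 R) :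
    |ψ' t * φ t - ψ t * φ' t| ≤
      |γ' - γ| * (ψ 0 * φ 0) + (2 * R * |ξ' - ξ| + |γ' ^ 2 - γ ^ 2|) := by
  have hφ := h.continuousOn
  have hψ := k.continuousOn
  have hφ' := h.continuousOn_deriv
  have hψ' := k.continuousOn_deriv
  have hsub : Icc 0 t ⊆ Ici (0:ℝ) := Icc_subset_Ici_self
  have hd : ∀ s ∈ Ioo 0 t, HasDerivAt (fun s => ψ' s * φ s - ψ s * φ' s)
      ((-2 * s * (ξ' - ξ) + (γ' ^ 2 - γ ^ 2)) * (ψ s * φ s)) s := by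
    intro s hs
    have hn : Ici (0:ℝ) ∈ nhds s := Ici_mem_nhds hs.1
    have hs0 : s ∈ Ici (0:ℝ) := hs.1.le
    refine ((((k.deriv2 s hs0).hasDerivAt hn).mul ((h.deriv1 s hs0).hasDerivAt hn)).sub
      (((k.deriv1 s hs0).hasDerivAt hn).mul ((h.deriv2 s hs0).hasDerivAt hn))).congr_deriv ?_
    linear_combination -(φ s) * k.eqn s hs0 + (ψ s) * h.eqn s hs0 +
      ψ s * φ s * k.sq_eq - ψ s * φ s * h.sq_eq
  have hi : IntervalIntegrable
      (fun s => (-2 * s * (ξ' - ξ) + (γ' ^ 2 - γ ^ 2)) * (ψ s * φ s)) volume 0 t := by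
    refine ContinuousOn.intervalIntegrable ?_
    rw [uIcc_of_le ht.1]
    exact ContinuousOn.mono (by fun_prop) hsub
  have hftc := intervalIntegral.integral_eq_sub_of_hasDerivAt_of_le ht.1
    (ContinuousOn.mono (by fun_prop) hsub) hd hi
  have h0 : |ψ' 0 * φ 0 - ψ 0 * φ' 0| = |γ' - γ| * (ψ 0 * φ 0) := by
    have hp := mul_pos (k.pos 0 self_mem_Ici) (h.pos 0 self_mem_Ici)
    rw [h.bc, k.bc, show γ' * ψ 0 * φ 0 - ψ 0 * (γ * φ 0) = (γ' - γ) * (ψ 0 * φ 0) by ring,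
      abs_mul, abs_of_pos hp]
  set ε := 2 * R * |ξ' - ξ| + |γ' ^ 2 - γ ^ 2| with hε
  have hε0 : 0 ≤ ε := by
    have : 0 ≤ R := ht.1.trans ht.2
    positivity
  have hsq : IntegrableOn (fun s => ε * ((ψ s ^ 2 + φ s ^ 2) / 2)) (Ioc 0 t) :=
    (((k.memL2.add h.memL2).div_const 2).const_mul ε).mono_measure
      (Measure.restrict_mono Ioc_subset_Ioi_self le_rfl)
  have hint : |∫ s in (0:ℝ)..t, (-2 * s * (ξ' - ξ) + (γ' ^ 2 - γ ^ 2)) * (ψ s * φ s)| ≤ ε := by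
    rw [intervalIntegral.integral_of_le ht.1, ← Real.norm_eq_abs]
    calc _ ≤ ∫ s in Ioc 0 t, ε * ((ψ s ^ 2 + φ s ^ 2) / 2) := by
          refine norm_integral_le_of_norm_le hsq ?_
          refine (ae_restrict_iff' measurableSet_Ioc).2 (ae_of_all _ fun s hs => ?_)
          have hs0 : s ∈ Ici (0:ℝ) := hs.1.le
          have hp := mul_pos (k.pos s hs0) (h.pos s hs0)
          rw [norm_mul, Real.norm_eq_abs, Real.norm_of_nonneg hp.le]
          have hb : |-2 * s * (ξ' - ξ) + (γ' ^ 2 - γ ^ 2)| ≤ ε := by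
            refine (abs_add_le _ _).trans ?_
            rw [hε, abs_mul, abs_mul, abs_of_pos hs.1]
            norm_num
            gcongr
            exact hs.2.trans ht.2
          gcongr
          linarith [two_mul_le_add_sq (ψ s) (φ s)]
      _ = ε * (((∫ s in Ioc 0 t, ψ s ^ 2) + ∫ s in Ioc 0 t, φ s ^ 2) / 2) := by
          rw [integral_const_mul, integral_div,
            integral_add (k.memL2.mono_set Ioc_subset_Ioi_self)
              (h.memL2.mono_set Ioc_subset_Ioi_self)]
      _ ≤ ε * 1 := by
          gcongr
          linarith [h.setIntegral_sq_le_one t, k.setIntegral_sq_le_one t]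
      _ = ε := mul_one ε
  have e : ψ' t * φ t - ψ t * φ' t = (ψ' 0 * φ 0 - ψ 0 * φ' 0) +
      ∫ s in (0:ℝ)..t, (-2 * s * (ξ' - ξ) + (γ' ^ 2 - γ ^ 2)) * (ψ s * φ s) := by
    rw [hftc]
    ring
  rw [e]
  refine (abs_add_le _ _).trans ?_
  rw [h0]
  gcongr

/-- The quotient of two ground states is almost constant on an interval on which their
Wronskian is small. -/
lemma abs_div_sub_div_le (h : IsGroundState γ ξ μ φ φ' φ'')
    {μ' : ℝ} (k : IsGroundState γ' ξ' μ' ψ ψ' ψ'') {R m w : ℝ} (hm : 0 < m)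
    (hφm : ∀ t ∈ Icc 0 R, m ≤ φ t) (hw : ∀ t ∈ Icc 0 R, |ψ' t * φ t - ψ t * φ' t| ≤ w)
    {t : ℝ} (ht : t ∈ Icc 0 R) : |ψ t / φ t - ψ 0 / φ 0| ≤ w / m ^ 2 * R := by
  have h0 : (0:ℝ) ∈ Icc 0 R := ⟨le_rfl, ht.1.trans ht.2⟩
  have hw0 : 0 ≤ w := (abs_nonneg _).trans (hw 0 h0)
  have hd : ∀ s ∈ Icc 0 R, HasDerivWithinAt (fun s => ψ s / φ s)
      ((ψ' s * φ s - ψ s * φ' s) / φ s ^ 2) (Icc 0 R) s := fun s hs =>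
    ((k.deriv1 s hs.1).div (h.deriv1 s hs.1) (h.pos s hs.1).ne').mono Icc_subset_Ici_self
  have hb : ∀ s ∈ Icc 0 R, ‖(ψ' s * φ s - ψ s * φ' s) / φ s ^ 2‖ ≤ w / m ^ 2 := by
    intro s hs
    rw [norm_div, Real.norm_eq_abs, Real.norm_of_nonneg (sq_nonneg _)]
    gcongr
    · exact hw s hs
    · exact hφm s hs
  refine ((convex_Icc 0 R).norm_image_sub_le_of_norm_hasDerivWithin_le hd hb h0 ht).trans ?_
  rw [sub_zero, Real.norm_of_nonneg ht.1]
  gcongr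
  exact ht.2

lemma abs_sq_div_sub_one_le (h : IsGroundState γ ξ (Theta γ) φ φ' φ'')
    (k : IsGroundState γ' ξ' (Theta γ') ψ ψ' ψ'') {R η : ℝ} (hR : 0 < R)
    (hη : ∀ t ∈ Icc 0 R, |ψ t / φ t - ψ 0 / φ 0| ≤ η) :
    |(ψ 0 / φ 0) ^ 2 - 1| ≤
      max ((ψ 0 / φ 0) ^ 2 * ((2 * Theta γ + γ ^ 2 - γ * φ 0 ^ 2) / R ^ 2))
        ((2 * Theta γ' + γ' ^ 2 - γ' * ψ 0 ^ 2) / R ^ 2) + (2 * (ψ 0 / φ 0) * η + η ^ 2) := by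
  have ha : 0 < ψ 0 / φ 0 := div_pos (k.pos 0 self_mem_Ici) (h.pos 0 self_mem_Ici)
  have hη0 : 0 ≤ η := (abs_nonneg _).trans (hη 0 ⟨le_rfl, hR.le⟩)
  have hP := h.one_sub_le_setIntegral_sq hR
  have hQ := k.one_sub_le_setIntegral_sq hR
  have hP1 := h.setIntegral_sq_le_one R
  have hQ1 := k.setIntegral_sq_le_one R
  set a := ψ 0 / φ 0
  set c := 2 * a * η + η ^ 2
  have hc0 : 0 ≤ c := by positivity
  have iφ := h.memL2.mono_set (Ioc_subset_Ioi_self (a := R) (b := 0))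
  have iψ := k.memL2.mono_set (Ioc_subset_Ioi_self (a := R) (b := 0))
  have hdiff : |(∫ t in Ioc 0 R, ψ t ^ 2) - a ^ 2 * ∫ t in Ioc 0 R, φ t ^ 2| ≤ c := by
    rw [← integral_const_mul, ← integral_sub iψ (iφ.const_mul _), ← Real.norm_eq_abs]
    calc _ ≤ ∫ t in Ioc 0 R, c * φ t ^ 2 := by
          refine norm_integral_le_of_norm_le (iφ.const_mul c) ?_
          refine (ae_restrict_iff' measurableSet_Ioc).2 (ae_of_all _ fun t ht => ?_)
          have hpos := h.pos t ht.1.le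
          have hb := hη t (Ioc_subset_Icc_self ht)
          set e := ψ t / φ t - a with he
          have hψ : ψ t = φ t * (a + e) := by rw [he]; field_simp; ring
          have e1 : ψ t ^ 2 - a ^ 2 * φ t ^ 2 = (2 * a * e + e ^ 2) * φ t ^ 2 := by
            rw [hψ]; ring
          rw [e1, norm_mul, Real.norm_of_nonneg (sq_nonneg (φ t)), Real.norm_eq_abs]
          gcongr
          refine (abs_add_le _ _).trans ?_
          rw [abs_mul, abs_of_pos (show 0 < 2 * a by positivity), abs_pow]
          exact add_le_add (by gcongr) (by gcongr)
      _ ≤ c * 1 := by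
          rw [integral_const_mul]
          exact mul_le_mul_of_nonneg_left hP1 hc0
      _ = c := mul_one c
  rw [abs_le] at hdiff
  have hP' := mul_le_mul_of_nonneg_left hP (sq_nonneg a)
  rw [abs_le]
  constructor
  · linarith [le_max_right (a ^ 2 * ((2 * Theta γ + γ ^ 2 - γ * φ 0 ^ 2) / R ^ 2))
      ((2 * Theta γ' + γ' ^ 2 - γ' * ψ 0 ^ 2) / R ^ 2),
      mul_le_mul_of_nonneg_left hP1 (sq_nonneg a)]
  · linarith [le_max_left (a ^ 2 * ((2 * Theta γ + γ ^ 2 - γ * φ 0 ^ 2) / R ^ 2))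
      ((2 * Theta γ' + γ' ^ 2 - γ' * ψ 0 ^ 2) / R ^ 2)]

end IsGroundState

section Family

variable {ξf : ℝ → ℝ} {φ φd φdd : ℝ → ℝ → ℝ}

/-- `φ_γ(0)²` is a supergradient of `Θ` at `γ`. -/
lemma Theta_le_add_mul (h : ∀ γ, IsGroundState γ (ξf γ) (Theta γ) (φ γ) (φd γ) (φdd γ))
    (γ γ' : ℝ) : Theta γ' ≤ Theta γ + (γ' - γ) * φ γ 0 ^ 2 := by
  simpa using (h γ).Theta_le (γ' - γ) 0

lemma antitone_sq_zero (h : ∀ γ, IsGroundState γ (ξf γ) (Theta γ) (φ γ) (φd γ) (φdd γ)) :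
    Antitone fun γ => φ γ 0 ^ 2 := by
  intro γ γ' hle
  rcases hle.eq_or_lt with rfl | hlt
  · exact le_rfl
  · dsimp only
    have h1 := Theta_le_add_mul h γ γ'
    have h2 := Theta_le_add_mul h γ' γ
    exact le_of_mul_le_mul_left (by linarith) (sub_pos.2 hlt)

lemma abs_Theta_sub_le (h : ∀ γ, IsGroundState γ (ξf γ) (Theta γ) (φ γ) (φd γ) (φdd γ))
    {γ γ' : ℝ} (hγ' : γ' ∈ Icc (γ - 1) (γ + 1)) :
    |Theta γ' - Theta γ| ≤ φ (γ - 1) 0 ^ 2 * |γ' - γ| := by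
  have hg : φ γ 0 ^ 2 ≤ φ (γ - 1) 0 ^ 2 := antitone_sq_zero h (by linarith)
  have hg' : φ γ' 0 ^ 2 ≤ φ (γ - 1) 0 ^ 2 := antitone_sq_zero h hγ'.1
  have h1 := Theta_le_add_mul h γ γ'
  have h2 := Theta_le_add_mul h γ' γ
  have b1 : |γ' - γ| * φ γ 0 ^ 2 ≤ |γ' - γ| * φ (γ - 1) 0 ^ 2 := by gcongr
  have b2 : |γ' - γ| * φ γ' 0 ^ 2 ≤ |γ' - γ| * φ (γ - 1) 0 ^ 2 := by gcongr
  have c1 : (γ' - γ) * φ γ 0 ^ 2 ≤ |γ' - γ| * φ γ 0 ^ 2 := by gcongr; exact le_abs_self _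
  have c2 : -|γ' - γ| * φ γ' 0 ^ 2 ≤ (γ' - γ) * φ γ' 0 ^ 2 := by gcongr; exact neg_abs_le _
  rw [abs_le]
  constructor <;> linarith

lemma continuousAt_Theta (h : ∀ γ, IsGroundState γ (ξf γ) (Theta γ) (φ γ) (φd γ) (φdd γ))
    (γ : ℝ) : ContinuousAt Theta γ := by
  refine tendsto_iff_norm_sub_tendsto_zero.2 (squeeze_zero' (Eventually.of_forall fun _ =>
    norm_nonneg _) (g := fun γ' => φ (γ - 1) 0 ^ 2 * |γ' - γ|) ?_ ?_)
  · filter_upwards [Icc_mem_nhds (sub_one_lt γ) (lt_add_one γ)] with γ' hγ'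
    exact abs_Theta_sub_le h hγ'
  · have : ContinuousAt (fun γ' => φ (γ - 1) 0 ^ 2 * |γ' - γ|) γ := by fun_prop
    simpa [ContinuousAt] using this

lemma continuousAt_minimizer (h : ∀ γ, IsGroundState γ (ξf γ) (Theta γ) (φ γ) (φd γ) (φdd γ))
    (hξ : ∀ γ, 0 < ξf γ) (γ : ℝ) : ContinuousAt ξf γ := by
  have e : ξf = fun γ => √(Theta γ + γ ^ 2) := by
    ext x
    rw [← (h x).sq_eq, Real.sqrt_sq (hξ x).le]
  rw [e]
  exact ((continuousAt_Theta h γ).add (by fun_prop)).sqrt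

/-- The boundary value `φ_γ(0)²` depends continuously on `γ`. -/
lemma continuousAt_sq_zero (h : ∀ γ, IsGroundState γ (ξf γ) (Theta γ) (φ γ) (φd γ) (φdd γ))
    (hξ : ∀ γ, 0 < ξf γ) (γ : ℝ) : ContinuousAt (fun γ' => φ γ' 0 ^ 2) γ := by
  have hpos0 : 0 < φ γ 0 := (h γ).pos 0 self_mem_Ici
  set G := φ (γ - 1) 0 ^ 2
  set A := √G / φ γ 0 with hA
  have hA0 : 0 ≤ A := by positivity
  set K := A ^ 2 * |2 * Theta γ + γ ^ 2 - γ * φ γ 0 ^ 2| +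
    |2 * (Theta γ + G) + (|γ| + 1) ^ 2 + (|γ| + 1) * G| with hK
  suffices hlim : Tendsto (fun γ' => (φ γ' 0 / φ γ 0) ^ 2) (nhds γ) (nhds 1) by
    have := hlim.mul_const (φ γ 0 ^ 2)
    rw [one_mul] at this
    refine this.congr fun γ' => ?_
    field_simp
  rw [Metric.tendsto_nhds]
  intro ε hε
  obtain ⟨R, hR, hKR⟩ : ∃ R : ℝ, 0 < R ∧ K / R ^ 2 < ε / 2 := by
    have : Tendsto (fun R : ℝ => K / R ^ 2) atTop (nhds 0) :=
      (tendsto_pow_atTop two_ne_zero).const_div_atTop _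
    obtain ⟨R, h1, h2⟩ := ((this.eventually_lt_const (half_pos hε)).and
      (eventually_gt_atTop 0)).exists
    exact ⟨R, h2, h1⟩
  obtain ⟨x, hx, hmin⟩ := isCompact_Icc.exists_isMinOn (nonempty_Icc.2 hR.le)
    ((h γ).continuousOn.mono Icc_subset_Ici_self)
  have hm : 0 < φ γ x := (h γ).pos x hx.1
  set η : ℝ → ℝ := fun γ' => (|γ' - γ| * G +
    (2 * R * |ξf γ' - ξf γ| + |γ' ^ 2 - γ ^ 2|)) / φ γ x ^ 2 * R with hη
  have hηlim : ∀ᶠ γ' in nhds γ, 2 * A * η γ' + η γ' ^ 2 < ε / 2 := by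
    have hξc := continuousAt_minimizer h hξ γ
    have : ContinuousAt (fun γ' => 2 * A * η γ' + η γ' ^ 2) γ := by
      simp only [hη]
      fun_prop
    refine this.eventually_lt_const ?_
    simp [hη, hε]
  filter_upwards [hηlim, Icc_mem_nhds (sub_one_lt γ) (lt_add_one γ)] with γ' hγη hγ'
  have hg : φ γ 0 ^ 2 ≤ G := antitone_sq_zero h (by linarith)
  have hg' : φ γ' 0 ^ 2 ≤ G := antitone_sq_zero h hγ'.1
  have hpos' : 0 < φ γ' 0 := (h γ').pos 0 self_mem_Ici
  have haA : φ γ' 0 / φ γ 0 ≤ A := by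
    rw [hA]
    gcongr
    exact Real.le_sqrt_of_sq_le hg'
  have hηb : ∀ t ∈ Icc 0 R, |φ γ' t / φ γ t - φ γ' 0 / φ γ 0| ≤ η γ' := by
    intro t ht
    refine (h γ).abs_div_sub_div_le (h γ') hm (fun s hs => hmin hs) (fun s hs => ?_) ht
    refine ((h γ).abs_wronskian_le (h γ') hs).trans ?_
    gcongr
    linarith [two_mul_le_add_sq (φ γ' 0) (φ γ 0)]
  have hη0 : 0 ≤ η γ' := (abs_nonneg _).trans (hηb 0 ⟨le_rfl, hR.le⟩)
  have habs : |γ' - γ| ≤ 1 := abs_le.2 ⟨by linarith [hγ'.1], by linarith [hγ'.2]⟩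
  have hG0 : 0 ≤ G := sq_nonneg _
  have hγb : |γ'| ≤ |γ| + 1 := by
    have := abs_sub_abs_le_abs_sub γ' γ
    linarith
  have hTheta : Theta γ' ≤ Theta γ + G := by
    have h1 := (le_abs_self _).trans (abs_Theta_sub_le h hγ')
    have h2 := mul_le_mul_of_nonneg_left habs hG0
    linarith
  have hK' : 2 * Theta γ' + γ' ^ 2 - γ' * φ γ' 0 ^ 2 ≤
      2 * (Theta γ + G) + (|γ| + 1) ^ 2 + (|γ| + 1) * G := by
    have h1 : γ' ^ 2 ≤ (|γ| + 1) ^ 2 := by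
      rw [← sq_abs γ']
      gcongr
    have h2 : -γ' * φ γ' 0 ^ 2 ≤ (|γ| + 1) * G := by
      gcongr
      exact (neg_le_abs γ').trans hγb
    linarith
  have hmax : max ((φ γ' 0 / φ γ 0) ^ 2 * ((2 * Theta γ + γ ^ 2 - γ * φ γ 0 ^ 2) / R ^ 2))
      ((2 * Theta γ' + γ' ^ 2 - γ' * φ γ' 0 ^ 2) / R ^ 2) ≤ K / R ^ 2 := by
    rw [mul_div_assoc', max_div_div_right (by positivity)]
    gcongr
    refine max_le ?_ ?_
    · have : (φ γ' 0 / φ γ 0) ^ 2 * (2 * Theta γ + γ ^ 2 - γ * φ γ 0 ^ 2) ≤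
          A ^ 2 * |2 * Theta γ + γ ^ 2 - γ * φ γ 0 ^ 2| := by
        refine (mul_le_mul_of_nonneg_left (le_abs_self _) (sq_nonneg _)).trans ?_
        gcongr
      rw [hK]
      linarith [abs_nonneg (2 * (Theta γ + G) + (|γ| + 1) ^ 2 + (|γ| + 1) * G)]
    · have : 0 ≤ A ^ 2 * |2 * Theta γ + γ ^ 2 - γ * φ γ 0 ^ 2| := by positivity
      rw [hK]
      linarith [le_abs_self (2 * (Theta γ + G) + (|γ| + 1) ^ 2 + (|γ| + 1) * G)]
  have key := (h γ).abs_sq_div_sub_one_le (h γ') hR hηb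
  have hη2 : 2 * (φ γ' 0 / φ γ 0) * η γ' ≤ 2 * A * η γ' := by gcongr
  rw [Real.dist_eq]
  linarith

end Family

/-- If for every `γ` there are a positive minimizer `ξ(γ)` of `ξ ↦ μ⁽¹⁾(γ,ξ)` with value
`Θ(γ)` and a ground state `φ_γ` of `H[γ,ξ(γ)]`, then `Θ` is differentiable everywhere
with `Θ'(γ) = |φ_γ(0)|²`. -/
theorem Theta_hasDerivAt (ξf : ℝ → ℝ) (φ φd φdd : ℝ → ℝ → ℝ)
    (h : ∀ γ : ℝ, 0 < ξf γ ∧ mu1 γ (ξf γ) = Theta γ ∧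
      IsGroundState γ (ξf γ) (Theta γ) (φ γ) (φd γ) (φdd γ)) :
    ∀ γ : ℝ, HasDerivAt Theta ((φ γ 0) ^ 2) γ := by
  intro γ
  have hgs : ∀ γ, IsGroundState γ (ξf γ) (Theta γ) (φ γ) (φd γ) (φdd γ) := fun γ => (h γ).2.2
  have hc := continuousAt_sq_zero hgs (fun γ => (h γ).1) γ
  rw [hasDerivAt_iff_isLittleO, Asymptotics.isLittleO_iff]
  intro c hc0
  filter_upwards [Metric.tendsto_nhds.1 hc c hc0] with γ' hγ'
  rw [Real.dist_eq] at hγ'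
  have h1 := Theta_le_add_mul hgs γ γ'
  have h2 := Theta_le_add_mul hgs γ' γ
  have h3 : |(γ' - γ) * (φ γ' 0 ^ 2 - φ γ 0 ^ 2)| ≤ c * |γ' - γ| := by
    rw [abs_mul, mul_comm]
    gcongr
  rw [Real.norm_eq_abs, Real.norm_eq_abs, smul_eq_mul]
  refine le_trans ?_ h3
  rw [abs_of_nonpos (by linarith)]
  refine le_trans ?_ (neg_le_abs _)
  linarith
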